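/- The combinatorial Goldman bracket does not depend on the choice of linear representatives of the two cyclic words: if V and W are primitive cyclically reduced words, k and l are positive integers, and a and b are integers, then Σ_{C ∈ LP(V_a, W_b)} k · l · s_{V_a,W_b}(i,j) · ⟦((V_a)_i)^k ((W_b)_j)^l⟧ = Σ_{C ∈ LP(V,W)} k · l · s_{V,W}(i,j) · ⟦(V_i)^k (W_j)^l⟧ in the free ℤ-module on conjugacy classes of FreeGroup S. -/

import Mathlib

namespace GoldmanPaper

variable {α : Type*} [Inhabited α]

/-- The letter of `V` at index `i`, indices taken modulo the length of `V`. -/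
def letterZ (V : List α) (i : ZMod V.length) : α := V.getD i.val default

/-- The cyclic rotation `V_i` for an index `i` mod the length of `V`. -/
def rotZ (V : List α) (i : ZMod V.length) : List α := V.rotate i.val

/-- The cyclic rotation `V_j` for an integer `j` (taken mod the length of `V`). -/
def rot (V : List α) (j : ℤ) : List α := V.rotate ((j % (V.length : ℤ)).toNat)

/-- `V^k`: the concatenation of `k` copies of `V`. -/
def wpow (V : List α) (k : ℕ) : List α := (List.replicate k V).flatten

/-- A word is primitive if it is not of the form `W^r` with `r ≥ 2`. -/
def Primitive (V : List α) : Prop := ¬ ∃ (W : List α) (r : ℕ), 2 ≤ r ∧ V = wpow W r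

/-- `V` is freely reduced: `v_{i+1} ≠ bar v_i` for all `i`. -/
def FreelyReduced (bar : α → α) (V : List α) : Prop :=
  ∀ i : ℕ, i + 1 < V.length → V.getD (i + 1) default ≠ bar (V.getD i default)

/-- `V` is cyclically reduced: nonempty, freely reduced, and `v_0 ≠ bar v_{n-1}`. -/
def CyclicallyReduced (bar : α → α) (V : List α) : Prop :=
  V ≠ [] ∧ FreelyReduced bar V ∧ V.getD 0 default ≠ bar (V.getD (V.length - 1) default)

/-- The generating step of the equivalence relation `R(V,W)` on `I(V,W)`:
rule 1 relates `(j,k)` with `(j+1,k+1)` whenever `v_j = w_k`; rule 2 relates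
`(j+1,k)` with `(j,k+1)` whenever `v_j = bar w_k`. -/
def Step (bar : α → α) (V W : List α) :
    ZMod V.length × ZMod W.length → ZMod V.length × ZMod W.length → Prop :=
  fun p q =>
    (q = (p.1 + 1, p.2 + 1) ∧ letterZ V p.1 = letterZ W p.2) ∨
    (q = (p.1 - 1, p.2 + 1) ∧ letterZ V (p.1 - 1) = bar (letterZ W p.2))

/-- The equivalence relation `R(V,W)` generated by rules 1 and 2. -/
def REq (bar : α → α) (V W : List α) :
    ZMod V.length × ZMod W.length → ZMod V.length × ZMod W.length → Prop :=
  Relation.EqvGen (Step bar V W)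

/-- A pair `(i,j) ∈ I(V,W)` is extremal if `v_i ≠ w_j` and `v_i ≠ bar w_{j-1}`. -/
def Extremal (bar : α → α) (V W : List α) (p : ZMod V.length × ZMod W.length) : Prop :=
  letterZ V p.1 ≠ letterZ W p.2 ∧ letterZ V p.1 ≠ bar (letterZ W (p.2 - 1))

section Order

variable [LinearOrder α]

/-- The order on `α` cyclically rotated so that `x` is the smallest element. -/
def cycLT (x a b : α) : Prop :=
  if (x ≤ a ∧ x ≤ b) ∨ (a < x ∧ b < x) then a < b else x ≤ a ∧ b < x

/-- The order on half-infinite words. -/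
def hwLT (bar : α → α) (T U : ℕ → α) : Prop :=
  T 0 < U 0 ∨ ∃ j : ℕ, (∀ i ≤ j, T i = U i) ∧ cycLT (bar (T j)) (T (j + 1)) (U (j + 1))

/-- A 4-tuple is linearly ordered: strictly increasing or strictly decreasing. -/
def LinOrd4 {β : Type*} (lt : β → β → Prop) (a b c d : β) : Prop :=
  (lt a b ∧ lt b c ∧ lt c d) ∨ (lt d c ∧ lt c b ∧ lt b a)

/-- A 4-tuple is cyclically ordered: some cyclic permutation is linearly ordered. -/
def CycOrd4 {β : Type*} (lt : β → β → Prop) (a b c d : β) : Prop :=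
  LinOrd4 lt a b c d ∨ LinOrd4 lt b c d a ∨ LinOrd4 lt c d a b ∨ LinOrd4 lt d a b c

/-- The half-infinite word `V_i^∞`. -/
def fwd (V : List α) (i : ZMod V.length) : ℕ → α :=
  fun t => letterZ V (i + (t : ZMod V.length))

/-- The half-infinite word `V_i^{-∞} = (bar V_i)^∞`. -/
def bwd (bar : α → α) (V : List α) (i : ZMod V.length) : ℕ → α :=
  fun t => bar (letterZ V (i - 1 - (t : ZMod V.length)))

open scoped Classical in
/-- The sign `s_{V,W}(i,j) ∈ {-1,0,1}`. -/
noncomputable def sgn (bar : α → α) (V W : List α)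
    (i : ZMod V.length) (j : ZMod W.length) : ℤ :=
  if CycOrd4 (hwLT bar) (fwd V i) (fwd W j) (bwd bar V i) (bwd bar W j) then 1
  else if CycOrd4 (hwLT bar) (fwd V i) (bwd bar W j) (bwd bar V i) (fwd W j) then -1
  else 0

end Order

/-- The involution `bar` on the alphabet `S × Bool`. -/
def pbar {S : Type*} : S × Bool → S × Bool := fun p => (p.1, !p.2)


/-- The combinatorial Goldman bracket `[V̂^k, Ŵ^l]` of the primitive cyclically reduced
words `V`, `W`: the sum over the `R(V,W)`-classes `C` (only classes of linking pairs
contribute, since the sign vanishes elsewhere) of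
`k·l·s_(V,W)(i,j)·⟦(V_i)^k (W_j)^l⟧`, `(i,j)` a representative of `C`. -/
noncomputable def bracket {S : Type*} [Inhabited S] [LinearOrder (S × Bool)]
    (V W : List (S × Bool)) (k l : ℕ) : ConjClasses (FreeGroup S) →₀ ℤ :=
  if h : V.length = 0 ∨ W.length = 0 then 0
  else
    haveI : NeZero V.length := ⟨fun hh => h (Or.inl hh)⟩
    haveI : NeZero W.length := ⟨fun hh => h (Or.inr hh)⟩
    haveI : Fintype (Quotient (Relation.EqvGen.setoid (Step pbar V W))) := Fintype.ofFinite _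
    ∑ C : Quotient (Relation.EqvGen.setoid (Step pbar V W)),
      Finsupp.single
        (ConjClasses.mk (FreeGroup.mk (wpow (rotZ V C.out.1) k ++ wpow (rotZ W C.out.2) l)))
        ((k : ℤ) * (l : ℤ) * sgn pbar V W C.out.1 C.out.2)


set_option linter.unusedSectionVars false

section Aux

theorem letterZ_natCast (V : List α) (m : ℕ) :
    letterZ V (m : ZMod V.length) = V.getD (m % V.length) default := by
  unfold letterZ
  rw [ZMod.val_natCast]

theorem natCast_surj (n : ℕ) (hn : n ≠ 0) (i : ZMod n) : ∃ m : ℕ, (m : ZMod n) = i := by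
  have : NeZero n := ⟨hn⟩
  exact ⟨i.val, ZMod.natCast_zmod_val i⟩

theorem rotZ_natCast (V : List α) (m : ℕ) :
    rotZ V (m : ZMod V.length) = V.rotate m := by
  unfold rotZ
  rw [ZMod.val_natCast, List.rotate_mod]

theorem letterZ_succ_ne (bar : α → α) (V : List α) (hV : CyclicallyReduced bar V)
    (i : ZMod V.length) : letterZ V (i + 1) ≠ bar (letterZ V i) := by
  obtain ⟨h0, h1, h2⟩ := hV
  have hn : V.length ≠ 0 := by simpa using h0
  obtain ⟨m, rfl⟩ := natCast_surj _ hn i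
  have : ((m : ZMod V.length) + 1) = ((m + 1 : ℕ) : ZMod V.length) := by push_cast; rfl
  rw [this, letterZ_natCast, letterZ_natCast]
  have hlt := Nat.mod_lt m (Nat.pos_of_ne_zero hn)
  by_cases h : m % V.length + 1 < V.length
  · have : (m + 1) % V.length = m % V.length + 1 := by
      rw [Nat.add_mod_eq_ite]
      rcases Nat.lt_or_ge 1 V.length with h' | h'
      · rw [Nat.mod_eq_of_lt h', if_neg (by omega)]
      · omega
    rw [this]
    exact h1 _ h
  · have e : m % V.length = V.length - 1 := by omega
    have : (m + 1) % V.length = 0 := by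
      rw [← Nat.mod_add_mod, e, Nat.sub_add_cancel (by omega), Nat.mod_self]
    rw [this, e]
    exact h2

/-- Reduced half-infinite words. -/
def HRed (bar : α → α) (T : ℕ → α) : Prop := ∀ n, T (n + 1) ≠ bar (T n)

/-- `T'` is the left translate of `T` by the letter `x`. -/
def Tr (bar : α → α) (x : α) (T T' : ℕ → α) : Prop :=
  HRed bar T ∧ HRed bar T' ∧
  ((T' 0 = x ∧ ∀ n, T' (n + 1) = T n) ∨ (T 0 = bar x ∧ ∀ n, T (n + 1) = T' n))

section Order
variable [LinearOrder α]

def Rest (bar : α → α) (T U : ℕ → α) : Prop :=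
  ∃ j : ℕ, (∀ i ≤ j, T i = U i) ∧ cycLT (bar (T j)) (T (j + 1)) (U (j + 1))

theorem hwLT_iff (bar : α → α) (T U : ℕ → α) :
    hwLT bar T U ↔ (T 0 < U 0 ∨ Rest bar T U) := Iff.rfl

theorem rest_zero (bar : α → α) (T U : ℕ → α) (h : Rest bar T U) : T 0 = U 0 := by
  obtain ⟨j, h, _⟩ := h
  exact h 0 (Nat.zero_le _)

theorem rest_shift (bar : α → α) (T U T' U' : ℕ → α) (h0 : T 0 = U 0)
    (hT : ∀ n, T (n + 1) = T' n) (hU : ∀ n, U (n + 1) = U' n) :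
    Rest bar T U ↔ (cycLT (bar (T 0)) (T' 0) (U' 0) ∨ Rest bar T' U') := by
  constructor
  · rintro ⟨j, h1, h2⟩
    cases j with
    | zero => left; simpa [← hT, ← hU] using h2
    | succ j =>
      right
      refine ⟨j, fun i hi => ?_, ?_⟩
      · rw [← hT, ← hU]; exact h1 _ (by omega)
      · rw [← hT, ← hT, ← hU]; exact h2
  · rintro (h | ⟨j, h1, h2⟩)
    · exact ⟨0, fun i hi => by obtain rfl : i = 0 := by omega
                               exact h0, by simpa [hT, hU] using h⟩
    · refine ⟨j + 1, fun i hi => ?_, ?_⟩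
      · cases i with
        | zero => exact h0
        | succ i => rw [hT, hU]; exact h1 _ (by omega)
      · rw [hT, hT, hU]; exact h2

/-- The lower side of the cut for translation by `x`. -/
def Lower (bar : α → α) (x : α) (T : ℕ → α) : Prop :=
  T 0 < bar x ∨ (T 0 = bar x ∧ x < T 1)

theorem tr_pair (bar : α → α) (hb : ∀ x, bar (bar x) = x) (x : α) (T T' U U' : ℕ → α)
    (hT : Tr bar x T T') (hU : Tr bar x U U') :
    ((Lower bar x T ↔ Lower bar x U) → (hwLT bar T' U' ↔ hwLT bar T U)) ∧
    ((Lower bar x T ∧ ¬ Lower bar x U) →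
      hwLT bar T U ∧ ¬ hwLT bar U T ∧ hwLT bar U' T' ∧ ¬ hwLT bar T' U') := by
  obtain ⟨rT, rT', hT⟩ := hT
  obtain ⟨rU, rU', hU⟩ := hU
  have z1 := rest_zero bar T U
  have z2 := rest_zero bar U T
  have z3 := rest_zero bar T' U'
  have z4 := rest_zero bar U' T'
  have a1 := rT 0
  have a2 := rT' 0
  have a3 := rU 0
  have a4 := rU' 0
  have hbx := hb x
  simp only [hwLT_iff, Lower]
  rcases hT with ⟨t0, t1⟩ | ⟨t0, t1⟩ <;> rcases hU with ⟨u0, u1⟩ | ⟨u0, u1⟩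
  · have r1 := rest_shift bar T' U' T U (t0.trans u0.symm) t1 u1
    have r2 := rest_shift bar U' T' U T (u0.trans t0.symm) u1 t1
    have b1 := t1 0
    have b2 := u1 0
    simp only [cycLT] at r1 r2
    simp only [zero_add] at *
    clear rT rT' rU rU' t1 u1
    rw [r1, r2]
    grind
  · have b1 := t1 0
    have b2 := u1 0
    simp only [zero_add] at *
    clear rT rT' rU rU' t1 u1
    grind
  · have b1 := t1 0
    have b2 := u1 0
    simp only [zero_add] at *
    clear rT rT' rU rU' t1 u1
    grind
  · have r1 := rest_shift bar T U T' U' (t0.trans u0.symm) t1 u1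
    have r2 := rest_shift bar U T U' T' (u0.trans t0.symm) u1 t1
    have b1 := t1 0
    have b2 := u1 0
    simp only [cycLT] at r1 r2
    simp only [zero_add] at *
    clear rT rT' rU rU' t1 u1
    rw [r1, r2]
    grind

set_option maxHeartbeats 2000000 in
theorem cycOrd4_tr (bar : α → α) (hb : ∀ x, bar (bar x) = x) (x : α)
    (a b c d a' b' c' d' : ℕ → α)
    (ha : Tr bar x a a') (hb' : Tr bar x b b') (hc : Tr bar x c c') (hd : Tr bar x d d') :
    CycOrd4 (hwLT bar) a' b' c' d' ↔ CycOrd4 (hwLT bar) a b c d := by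
  have ab := tr_pair bar hb x _ _ _ _ ha hb'
  have ba := tr_pair bar hb x _ _ _ _ hb' ha
  have bc := tr_pair bar hb x _ _ _ _ hb' hc
  have cb := tr_pair bar hb x _ _ _ _ hc hb'
  have cd := tr_pair bar hb x _ _ _ _ hc hd
  have dc := tr_pair bar hb x _ _ _ _ hd hc
  have da := tr_pair bar hb x _ _ _ _ hd ha
  have ad := tr_pair bar hb x _ _ _ _ ha hd
  simp only [CycOrd4, LinOrd4]
  by_cases pa : Lower bar x a <;> by_cases pb : Lower bar x b <;>
  by_cases pc : Lower bar x c <;> by_cases pd : Lower bar x d <;>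
  simp only [pa, pb, pc, pd, true_and, and_true, not_true, not_false_iff, and_false, false_and,
    iff_self, forall_const, IsEmpty.forall_iff, iff_false, iff_true, false_iff, true_iff]
    at ab ba bc cb cd dc da ad <;>
  simp only [ab, ba, bc, cb, cd, dc, da, ad, true_and, and_true, and_false, false_and,
    or_false, false_or] <;> clear ab ba bc cb cd dc da ad ha hb' hc hd <;> grind

theorem hred_fwd (bar : α → α) (V : List α) (hV : CyclicallyReduced bar V)
    (i : ZMod V.length) : HRed bar (fwd V i) := by
  intro n
  have := letterZ_succ_ne bar V hV (i + n)
  simpa [fwd, add_assoc] using this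

theorem hred_bwd (bar : α → α) (hb : ∀ x, bar (bar x) = x)
    (V : List α) (hV : CyclicallyReduced bar V)
    (i : ZMod V.length) : HRed bar (bwd bar V i) := by
  intro n h
  have := letterZ_succ_ne bar V hV (i - 1 - (n + 1))
  apply this
  simp only [bwd, hb, Nat.cast_add, Nat.cast_one] at h
  rw [h]; congr 1; ring

theorem tr_fwd_up (bar : α → α) (hb : ∀ x, bar (bar x) = x)
    (V : List α) (hV : CyclicallyReduced bar V) (i : ZMod V.length) :
    Tr bar (bar (letterZ V i)) (fwd V i) (fwd V (i + 1)) := by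
  refine ⟨hred_fwd _ _ hV _, hred_fwd _ _ hV _, Or.inr ⟨by simp [fwd, hb], fun n => ?_⟩⟩
  simp only [fwd]; congr 1; push_cast; ring

theorem tr_bwd_up (bar : α → α) (hb : ∀ x, bar (bar x) = x)
    (V : List α) (hV : CyclicallyReduced bar V) (i : ZMod V.length) :
    Tr bar (bar (letterZ V i)) (bwd bar V i) (bwd bar V (i + 1)) := by
  refine ⟨hred_bwd _ hb _ hV _, hred_bwd _ hb _ hV _, Or.inl ⟨by simp [bwd], fun n => ?_⟩⟩
  simp only [bwd]; congr 2; push_cast; ring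

theorem tr_fwd_down (bar : α → α)
    (V : List α) (hV : CyclicallyReduced bar V) (i : ZMod V.length) :
    Tr bar (letterZ V (i - 1)) (fwd V i) (fwd V (i - 1)) := by
  refine ⟨hred_fwd _ _ hV _, hred_fwd _ _ hV _, Or.inl ⟨by simp [fwd], fun n => ?_⟩⟩
  simp only [fwd]; congr 1; push_cast; ring

theorem tr_bwd_down (bar : α → α) (hb : ∀ x, bar (bar x) = x)
    (V : List α) (hV : CyclicallyReduced bar V) (i : ZMod V.length) :
    Tr bar (letterZ V (i - 1)) (bwd bar V i) (bwd bar V (i - 1)) := by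
  refine ⟨hred_bwd _ hb _ hV _, hred_bwd _ hb _ hV _, Or.inr ⟨by simp [bwd], fun n => ?_⟩⟩
  simp only [bwd]; congr 2; push_cast; ring

theorem sgn_step (bar : α → α) (hb : ∀ x, bar (bar x) = x) (V W : List α)
    (hV : CyclicallyReduced bar V) (hW : CyclicallyReduced bar W)
    (p q : ZMod V.length × ZMod W.length) (h : Step bar V W p q) :
    sgn bar V W q.1 q.2 = sgn bar V W p.1 p.2 := by
  obtain ⟨x, h1, h2, h3, h4⟩ : ∃ x, Tr bar x (fwd V p.1) (fwd V q.1) ∧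
      Tr bar x (bwd bar V p.1) (bwd bar V q.1) ∧ Tr bar x (fwd W p.2) (fwd W q.2) ∧
      Tr bar x (bwd bar W p.2) (bwd bar W q.2) := by
    rcases h with ⟨rfl, h⟩ | ⟨rfl, h⟩
    · refine ⟨bar (letterZ V p.1), tr_fwd_up bar hb V hV _, tr_bwd_up bar hb V hV _, ?_, ?_⟩
      · rw [h]; exact tr_fwd_up bar hb W hW _
      · rw [h]; exact tr_bwd_up bar hb W hW _
    · refine ⟨letterZ V (p.1 - 1), tr_fwd_down bar V hV _, tr_bwd_down bar hb V hV _, ?_, ?_⟩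
      · rw [h]; exact tr_fwd_up bar hb W hW _
      · rw [h]; exact tr_bwd_up bar hb W hW _
  unfold sgn
  rw [cycOrd4_tr bar hb x _ _ _ _ _ _ _ _ h1 h3 h2 h4,
    cycOrd4_tr bar hb x _ _ _ _ _ _ _ _ h1 h4 h2 h3]

end Order

theorem rot_length (V : List α) (a : ℤ) : (rot V a).length = V.length := by simp [rot]

/-- Shift of indices for a rotated word. -/
def shiftE (V : List α) (a : ℤ) : ZMod (rot V a).length ≃ ZMod V.length :=
  (ZMod.ringEquivCongr (rot_length V a)).toEquiv.trans (Equiv.addRight (a : ZMod V.length))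

theorem shiftE_apply (V : List α) (a : ℤ) (i) :
    shiftE V a i = ZMod.ringEquivCongr (rot_length V a) i + a := rfl

theorem shiftE_natCast (V : List α) (a : ℤ) (hV : V ≠ []) (m : ℕ) :
    shiftE V a m = ((m + (a % (V.length : ℤ)).toNat : ℕ) : ZMod V.length) := by
  rw [shiftE_apply, map_natCast]
  push_cast
  congr 1
  have h : (0 : ℤ) ≤ a % V.length := Int.emod_nonneg _ (by simpa using hV)
  have : (((a % (V.length : ℤ)).toNat : ℤ) : ZMod V.length) = (a : ZMod V.length) := by
    rw [Int.toNat_of_nonneg h, ZMod.intCast_mod]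
  rw [← this, Int.cast_natCast]

theorem shiftE_add (V : List α) (a : ℤ) (i) (t : ℕ) : shiftE V a (i + t) = shiftE V a i + t := by
  simp only [shiftE_apply, map_add, map_natCast]; ring

theorem shiftE_add_one (V : List α) (a : ℤ) (i) : shiftE V a (i + 1) = shiftE V a i + 1 := by
  simp only [shiftE_apply, map_add, map_one]; ring

theorem shiftE_sub_one (V : List α) (a : ℤ) (i) : shiftE V a (i - 1) = shiftE V a i - 1 := by
  simp only [shiftE_apply, map_sub, map_one]; ring

theorem shiftE_sub (V : List α) (a : ℤ) (i) (t : ℕ) :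
    shiftE V a (i - 1 - t) = shiftE V a i - 1 - t := by
  simp only [shiftE_apply, map_sub, map_natCast, map_one]; ring

theorem rot_ne (V : List α) (a : ℤ) (hV : V ≠ []) : rot V a ≠ [] := by
  simpa [rot] using hV

theorem rotZ_rot (V : List α) (a : ℤ) (hV : V ≠ []) (i) :
    rotZ (rot V a) i = rotZ V (shiftE V a i) := by
  obtain ⟨m, rfl⟩ := natCast_surj _ (by simpa using rot_ne V a hV) i
  rw [shiftE_natCast V a hV, rotZ_natCast, rotZ_natCast, rot, List.rotate_rotate, add_comm]

theorem letterZ_eq_rotZ (V : List α) (hV : V ≠ []) (i) :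
    letterZ V i = (rotZ V i).getD 0 default := by
  have hn : V.length ≠ 0 := by simpa using hV
  obtain ⟨m, rfl⟩ := natCast_surj _ hn i
  rw [letterZ_natCast, rotZ_natCast]
  have h := Nat.mod_lt m (Nat.pos_of_ne_zero hn)
  have h' : 0 < (V.rotate m).length := by simpa using Nat.pos_of_ne_zero hn
  rw [List.getD_eq_getElem _ _ h, List.getD_eq_getElem _ _ h', List.getElem_rotate]
  simp

theorem letterZ_rot (V : List α) (a : ℤ) (hV : V ≠ []) (i) :
    letterZ (rot V a) i = letterZ V (shiftE V a i) := by
  rw [letterZ_eq_rotZ _ (rot_ne V a hV), letterZ_eq_rotZ _ hV, rotZ_rot V a hV]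

theorem fwd_rot [LinearOrder α] (V : List α) (a : ℤ) (hV : V ≠ []) (i) :
    fwd (rot V a) i = fwd V (shiftE V a i) := by
  funext t
  simp only [fwd, letterZ_rot V a hV, shiftE_add]

theorem bwd_rot [LinearOrder α] (bar : α → α) (V : List α) (a : ℤ) (hV : V ≠ []) (i) :
    bwd bar (rot V a) i = bwd bar V (shiftE V a i) := by
  funext t
  simp only [bwd, letterZ_rot V a hV, shiftE_sub]

theorem sgn_rot [LinearOrder α] (bar : α → α) (V W : List α) (a b : ℤ) (hV : V ≠ [])
    (hW : W ≠ []) (i j) :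
    sgn bar (rot V a) (rot W b) i j = sgn bar V W (shiftE V a i) (shiftE W b j) := by
  unfold sgn
  rw [fwd_rot V a hV i, fwd_rot W b hW j, bwd_rot bar V a hV i, bwd_rot bar W b hW j]

theorem step_rot (bar : α → α) (V W : List α) (a b : ℤ) (hV : V ≠ [])
    (hW : W ≠ []) (p q) :
    Step bar (rot V a) (rot W b) p q ↔
      Step bar V W (Equiv.prodCongr (shiftE V a) (shiftE W b) p)
        (Equiv.prodCongr (shiftE V a) (shiftE W b) q) := by
  obtain ⟨p1, p2⟩ := p
  obtain ⟨q1, q2⟩ := q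
  simp only [Step, Equiv.prodCongr_apply, Prod.map, Prod.mk.injEq, letterZ_rot V a hV,
    letterZ_rot W b hW, shiftE_sub_one, ← shiftE_add_one, EmbeddingLike.apply_eq_iff_eq]
  simp only [← shiftE_sub_one, EmbeddingLike.apply_eq_iff_eq]

end Aux

section Grp
variable {S : Type*} [Inhabited S]

theorem mk_wpow (V : List (S × Bool)) (k : ℕ) :
    FreeGroup.mk (wpow V k) = FreeGroup.mk V ^ k := by
  induction k with
  | zero => rfl
  | succ k ih =>
    rw [pow_succ', ← ih, FreeGroup.mul_mk]
    simp [wpow, List.replicate_succ]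

theorem mk_pbar (x : S × Bool) : FreeGroup.mk [pbar x] = (FreeGroup.mk [x])⁻¹ := by
  simp [FreeGroup.inv_mk, FreeGroup.invRev, pbar]

theorem mk_rotZ_succ (V : List (S × Bool)) (hV : V ≠ []) (i : ZMod V.length) :
    FreeGroup.mk (rotZ V (i + 1)) =
      (FreeGroup.mk [letterZ V i])⁻¹ * FreeGroup.mk (rotZ V i) * FreeGroup.mk [letterZ V i] := by
  rw [letterZ_eq_rotZ V hV]
  have hn : V.length ≠ 0 := by simpa using hV
  obtain ⟨m, rfl⟩ := natCast_surj _ hn i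
  have : ((m : ZMod V.length) + 1) = ((m + 1 : ℕ) : ZMod V.length) := by push_cast; rfl
  rw [this, rotZ_natCast, rotZ_natCast, ← List.rotate_rotate]
  have h' : V.rotate m ≠ [] := by simpa using hV
  generalize V.rotate m = L at h'
  cases L with
  | nil => exact absurd rfl h'
  | cons x L =>
    have e : FreeGroup.mk (x :: L) = FreeGroup.mk [x] * FreeGroup.mk L := by
      rw [FreeGroup.mul_mk]; rfl
    simp only [List.rotate_cons_succ, List.rotate_zero, List.getD_cons_zero, e,
      ← FreeGroup.mul_mk]
    group

theorem conj_step (V W : List (S × Bool)) (hV : V ≠ []) (hW : W ≠ []) (k l : ℕ)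
    (p q : ZMod V.length × ZMod W.length) (h : Step pbar V W p q) :
    ConjClasses.mk (FreeGroup.mk (wpow (rotZ V q.1) k ++ wpow (rotZ W q.2) l)) =
    ConjClasses.mk (FreeGroup.mk (wpow (rotZ V p.1) k ++ wpow (rotZ W p.2) l)) := by
  obtain ⟨g, h1, h2⟩ : ∃ g : FreeGroup S,
      FreeGroup.mk (rotZ V q.1) = g * FreeGroup.mk (rotZ V p.1) * g⁻¹ ∧
      FreeGroup.mk (rotZ W q.2) = g * FreeGroup.mk (rotZ W p.2) * g⁻¹ := by
    rcases h with ⟨rfl, h⟩ | ⟨rfl, h⟩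
    · refine ⟨(FreeGroup.mk [letterZ V p.1])⁻¹, ?_, ?_⟩
      · rw [mk_rotZ_succ V hV, inv_inv]
      · rw [mk_rotZ_succ W hW, inv_inv, h]
    · refine ⟨(FreeGroup.mk [letterZ W p.2])⁻¹, ?_, ?_⟩
      · have := mk_rotZ_succ V hV (p.1 - 1)
        rw [sub_add_cancel, h, mk_pbar] at this
        rw [this]; group
      · rw [mk_rotZ_succ W hW, inv_inv]
  rw [eq_comm, ConjClasses.mk_eq_mk_iff_isConj, isConj_iff]
  refine ⟨g, ?_⟩
  simp only [← FreeGroup.mul_mk, mk_wpow, h1, h2, conj_pow]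
  group

end Grp

theorem statement15 {S : Type*} [Inhabited S] [LinearOrder (S × Bool)]
    (V W : List (S × Bool))
    (hV : CyclicallyReduced pbar V) (hW : CyclicallyReduced pbar W)
    (hVprim : Primitive V) (hWprim : Primitive W)
    (k l : ℕ) (hk : 0 < k) (hl : 0 < l) (a b : ℤ) :
    bracket (rot V a) (rot W b) k l = bracket V W k l := by
  have hV0 := hV.1
  have hW0 := hW.1
  have hb : ∀ x : S × Bool, pbar (pbar x) = x := fun x => by simp [pbar]
  unfold bracket
  rw [dif_neg (by simp [hV0, hW0, rot_length]), dif_neg (by simp [hV0, hW0])]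
  let E := Equiv.prodCongr (shiftE V a) (shiftE W b)
  have hE : ∀ p q, (Relation.EqvGen.setoid (Step pbar (rot V a) (rot W b))) p q ↔
      (Relation.EqvGen.setoid (Step pbar V W)) (E p) (E q) := by
    intro p q
    constructor
    · intro h
      change Relation.EqvGen _ _ _ at h
      change Relation.EqvGen _ _ _
      induction h with
      | rel x y h => exact .rel _ _ ((step_rot pbar V W a b hV0 hW0 x y).1 h)
      | refl x => exact .refl _
      | symm x y _ ih => exact .symm _ _ ih
      | trans x y z _ _ ih1 ih2 => exact .trans _ _ _ ih1 ih2
    · intro h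
      change Relation.EqvGen _ _ _ at h
      change Relation.EqvGen _ _ _
      have key : ∀ u v, Relation.EqvGen (Step pbar V W) u v →
          Relation.EqvGen (Step pbar (rot V a) (rot W b)) (E.symm u) (E.symm v) := by
        intro u v h
        induction h with
        | rel x y h =>
          refine .rel _ _ ((step_rot pbar V W a b hV0 hW0 _ _).2 ?_)
          change Step pbar V W (E (E.symm x)) (E (E.symm y))
          simpa using h
        | refl x => exact .refl _
        | symm x y _ ih => exact .symm _ _ ih
        | trans x y z _ _ ih1 ih2 => exact .trans _ _ _ ih1 ih2
      simpa using key _ _ h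
  let F : ZMod V.length × ZMod W.length → (ConjClasses (FreeGroup S) →₀ ℤ) := fun p =>
    Finsupp.single
        (ConjClasses.mk (FreeGroup.mk (wpow (rotZ V p.1) k ++ wpow (rotZ W p.2) l)))
        ((k : ℤ) * (l : ℤ) * sgn pbar V W p.1 p.2)
  have hF : ∀ p q, (Relation.EqvGen.setoid (Step pbar V W)) p q → F p = F q := by
    intro p q h
    change Relation.EqvGen _ _ _ at h
    induction h with
    | rel x y h =>
      simp only [F]
      rw [conj_step V W hV0 hW0 k l x y h, sgn_step pbar hb V W hV hW x y h]
    | refl x => rfl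
    | symm x y _ ih => exact ih.symm
    | trans x y z _ _ ih1 ih2 => exact ih1.trans ih2
  refine @Fintype.sum_equiv _ _ _ (_) (_) _ (Quotient.congr E hE) _ _ ?_
  intro C
  rw [rotZ_rot V a hV0, rotZ_rot W b hW0, sgn_rot pbar V W a b hV0 hW0]
  change F (E C.out) = F (Quotient.out _)
  apply hF
  apply Quotient.exact
  rw [Quotient.out_eq]
  conv_rhs => rw [← Quotient.out_eq C]
  rfl

end GoldmanPaper
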